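/- arXiv:1304.3009 — 2 statements merged into one kernel-verified Lean document; each statement's English description precedes it below -/
import Mathlib

section
/- Let a₀, a₁, …, a_k, b₀, b₁, …, b_h ∈ ℕ₀. Then the strings ⟨a₀, a₁, …, a_k⟩ and ⟨b₀, b₁, …, b_h⟩ are u-equivalent if and only if for every idempotent ultrafilter U on ℕ₀ one has a₀U ⊕ a₁U ⊕ … ⊕ a_kU = b₀U ⊕ b₁U ⊕ … ⊕ b_hU. -/
open Ultrafilter Polynomial

/-- The pseudo-sum `U ⊕ V` of ultrafilters on `ℕ`:
`A ∈ U ⊕ V ↔ {n | {m | n + m ∈ A} ∈ V} ∈ U`. -/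
def pseudoSum (U V : Ultrafilter ℕ) : Ultrafilter ℕ :=
  U.bind fun n => V.map fun m => n + m

/-- The product `h U` of an ultrafilter on `ℕ` by a natural number:
`A ∈ h U ↔ {n | n * h ∈ A} ∈ U`. -/
def smulU (h : ℕ) (U : Ultrafilter ℕ) : Ultrafilter ℕ :=
  U.map fun n => n * h

/-- `U` is idempotent: non-principal and `U ⊕ U = U`. -/
def IsIdempotentUF (U : Ultrafilter ℕ) : Prop :=
  (∀ n : ℕ, U ≠ pure n) ∧ pseudoSum U U = U

/-- The linear combination `d₀ U ⊕ d₁ U ⊕ … ⊕ dₙ U` associated to the string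
`⟨d₀, …, dₙ⟩`; the empty string gives the principal ultrafilter at `0`. -/
def oplusU (U : Ultrafilter ℕ) : List ℕ → Ultrafilter ℕ
  | [] => pure 0
  | [d] => smulU d U
  | d :: l => pseudoSum (smulU d U) (oplusU U l)

/-- `u`-equivalence: the smallest equivalence relation on finite strings of
integers containing `ε ≈ᵤ ⟨0⟩`, `⟨a⟩ ≈ᵤ ⟨a,a⟩`, and coherent with concatenation. -/
inductive UEquiv : List ℤ → List ℤ → Prop where
  | nil_zero : UEquiv [] [0]
  | dup (a : ℤ) : UEquiv [a] [a, a]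
  | refl (l : List ℤ) : UEquiv l l
  | symm {l₁ l₂ : List ℤ} : UEquiv l₁ l₂ → UEquiv l₂ l₁
  | trans {l₁ l₂ l₃ : List ℤ} : UEquiv l₁ l₂ → UEquiv l₂ l₃ → UEquiv l₁ l₃
  | append {σ σ' τ τ' : List ℤ} : UEquiv σ σ' → UEquiv τ τ' →
      UEquiv (σ ++ τ) (σ' ++ τ')

theorem eventually_pseudoSum {U V : Ultrafilter ℕ} {p : ℕ → Prop} :
    (∀ᶠ n in pseudoSum U V, p n) ↔ ∀ᶠ m in U, ∀ᶠ m' in V, p (m + m') :=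
  Iff.rfl

theorem eventually_smulU {d : ℕ} {U : Ultrafilter ℕ} {p : ℕ → Prop} :
    (∀ᶠ n in smulU d U, p n) ↔ ∀ᶠ m in U, p (m * d) :=
  Iff.rfl

theorem Ultrafilter.ext_eventually {α : Type*} {U V : Ultrafilter α}
    (h : ∀ p : α → Prop, (∀ᶠ n in U, p n) ↔ ∀ᶠ n in V, p n) : U = V :=
  Ultrafilter.ext fun s => h (· ∈ s)

theorem pseudoSum_assoc (U V W : Ultrafilter ℕ) :
    pseudoSum (pseudoSum U V) W = pseudoSum U (pseudoSum V W) :=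
  Ultrafilter.ext_eventually fun p => by simp only [eventually_pseudoSum, add_assoc]

theorem pseudoSum_pure_zero (U : Ultrafilter ℕ) : pseudoSum U (pure 0) = U :=
  Ultrafilter.ext_eventually fun p => by
    simp [eventually_pseudoSum, Ultrafilter.coe_pure]

theorem pure_zero_pseudoSum (U : Ultrafilter ℕ) : pseudoSum (pure 0) U = U :=
  Ultrafilter.ext_eventually fun p => by
    simp [eventually_pseudoSum, Ultrafilter.coe_pure]

theorem smulU_zero (U : Ultrafilter ℕ) : smulU 0 U = pure 0 :=
  Ultrafilter.ext_eventually fun p => by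
    simp [eventually_smulU, Ultrafilter.coe_pure]

theorem smulU_pseudoSum (d : ℕ) (U V : Ultrafilter ℕ) :
    smulU d (pseudoSum U V) = pseudoSum (smulU d U) (smulU d V) :=
  Ultrafilter.ext_eventually fun p => by
    simp only [eventually_smulU, eventually_pseudoSum, add_mul]

theorem oplusU_cons (U : Ultrafilter ℕ) (d : ℕ) (l : List ℕ) :
    oplusU U (d :: l) = pseudoSum (smulU d U) (oplusU U l) := by
  cases l with
  | nil => exact (pseudoSum_pure_zero _).symm
  | cons => rfl

theorem oplusU_append (U : Ultrafilter ℕ) (l l' : List ℕ) :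
    oplusU U (l ++ l') = pseudoSum (oplusU U l) (oplusU U l') := by
  induction l with
  | nil => exact (pure_zero_pseudoSum _).symm
  | cons d l ih => rw [List.cons_append, oplusU_cons, oplusU_cons, ih, pseudoSum_assoc]

theorem UEquiv.oplusU_map_toNat_eq {U : Ultrafilter ℕ} (hU : pseudoSum U U = U)
    {l l' : List ℤ} (h : UEquiv l l') :
    oplusU U (l.map Int.toNat) = oplusU U (l'.map Int.toNat) := by
  induction h with
  | nil_zero => exact (smulU_zero U).symm
  | dup a =>
    change smulU a.toNat U = pseudoSum (smulU a.toNat U) (smulU a.toNat U)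
    rw [← smulU_pseudoSum, hU]
  | refl => rfl
  | symm _ ih => exact ih.symm
  | trans _ _ ih ih' => exact ih.trans ih'
  | append _ _ ih ih' => simp only [List.map_append, oplusU_append, ih, ih']

/-- The base `B` digits of `n`, least significant first, as a string of integers. -/
def digitString (B n : ℕ) : List ℤ :=
  (Nat.digits B n).map Nat.cast

theorem digitString_uequiv_cons {B : ℕ} (hB : 1 < B) (n : ℕ) :
    UEquiv (digitString B n) (((n % B : ℕ) : ℤ) :: digitString B (n / B)) := by
  rcases Nat.eq_zero_or_pos n with rfl | hn
  · simpa [digitString] using UEquiv.nil_zero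
  · rw [digitString, Nat.digits_def' hB hn]
    exact UEquiv.refl _

theorem digitString_add_pow_mul {B : ℕ} (hB : 1 < B) (N : ℕ) {x : ℕ} (y : ℕ) (hx : x < B ^ N) :
    UEquiv (digitString B (x + B ^ N * y)) (digitString B x ++ digitString B y) := by
  induction N generalizing x with
  | zero =>
    obtain rfl : x = 0 := by simpa using hx
    simpa [digitString] using UEquiv.refl _
  | succ N ih =>
    have hB0 : 0 < B := by omega
    have hdiv : x / B < B ^ N := Nat.div_lt_of_lt_mul (by rwa [← pow_succ'])
    have e : x + B ^ (N + 1) * y = x + B * (B ^ N * y) := by ring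
    have h := digitString_uequiv_cons hB (x + B ^ (N + 1) * y)
    rw [e, Nat.add_mul_mod_self_left, Nat.add_mul_div_left _ _ hB0] at h
    rw [e]
    refine h.trans ((UEquiv.append (UEquiv.refl [((x % B : ℕ) : ℤ)]) (ih hdiv)).trans ?_)
    rw [← List.append_assoc]
    exact UEquiv.append (digitString_uequiv_cons hB x).symm (UEquiv.refl _)

theorem digitString_add_of_dvd {B : ℕ} (hB : 1 < B) (N : ℕ) {x z : ℕ} (hx : x < B ^ N)
    (hz : B ^ N ∣ z) :
    UEquiv (digitString B (x + z)) (digitString B x ++ digitString B z) := by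
  obtain ⟨y, rfl⟩ := hz
  have h := digitString_add_pow_mul hB N y (x := 0) (by positivity)
  rw [zero_add] at h
  exact (digitString_add_pow_mul hB N y hx).trans
    (UEquiv.append (UEquiv.refl _) (by simpa [digitString] using h.symm))

theorem digitString_pow_mul {B : ℕ} (hB : 1 < B) (N : ℕ) {d : ℕ} (hd : d < B) :
    UEquiv (digitString B (B ^ N * d)) [(d : ℤ)] := by
  have h := digitString_add_pow_mul hB N d (x := 0) (by positivity)
  have h' := digitString_uequiv_cons hB d
  rw [Nat.mod_eq_of_lt hd, Nat.div_eq_of_lt hd] at h'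
  rw [zero_add] at h
  simpa [digitString] using h.trans (by simpa [digitString] using h')

theorem digitString_mul_of_mem_FS {B : ℕ} (hB : 1 < B) {d : ℕ} (hd : d < B) {s : Stream' ℕ}
    {x : ℕ} (hx : x ∈ Hindman.FS s) (k : ℕ) (hs : ∀ i, s.get i = B ^ (k + i)) :
    UEquiv (digitString B (x * d)) [(d : ℤ)] ∧ B ^ k ∣ x ∧ 0 < x := by
  have hpos (j : ℕ) : 0 < B ^ j := by positivity
  induction hx generalizing k with
  | head' s =>
    have e : s.head = B ^ k := hs 0
    rw [e]
    exact ⟨digitString_pow_mul hB k hd, dvd_rfl, hpos k⟩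
  | tail' s m _ ih =>
    obtain ⟨h, hdvd, hx⟩ := ih (k + 1) fun i => by
      rw [Stream'.get_tail, hs]; ring
    exact ⟨h, (pow_dvd_pow B k.le_succ).trans hdvd, hx⟩
  | cons' s m _ ih =>
    obtain ⟨h, hdvd, hx⟩ := ih (k + 1) fun i => by
      rw [Stream'.get_tail, hs]; ring
    have e : s.head = B ^ k := hs 0
    rw [e, add_mul]
    refine ⟨?_, dvd_add dvd_rfl ((pow_dvd_pow B k.le_succ).trans hdvd),
      Nat.add_pos_right _ hx⟩
    have hlt : B ^ k * d < B ^ (k + 1) := by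
      rw [pow_succ]
      exact Nat.mul_lt_mul_of_pos_left hd (by positivity)
    exact (digitString_add_of_dvd hB (k + 1) hlt (hdvd.mul_right d)).trans
      ((UEquiv.append (digitString_pow_mul hB k hd) h).trans (UEquiv.dup _).symm)

theorem eventually_dvd_of_pseudoSum_self {U : Ultrafilter ℕ} (hU : pseudoSum U U = U)
    (m : ℕ) [NeZero m] : ∀ᶠ n in U, m ∣ n := by
  obtain ⟨z, hz⟩ := Ultrafilter.eq_pure_of_finite (U.map fun n : ℕ => (n : ZMod m))
  have h : ∀ᶠ n : ℕ in U, (n : ZMod m) = z := by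
    have : ∀ᶠ w in U.map fun n : ℕ => (n : ZMod m), w = z := by
      rw [hz]; simp [Ultrafilter.coe_pure]
    exact this
  have h2 := h
  rw [← hU, eventually_pseudoSum] at h2
  obtain ⟨n, hn, hn'⟩ := (h.and h2).exists
  obtain ⟨n', hn1, hn2⟩ := (h.and hn').exists
  have hz0 : z = 0 := by
    rw [Nat.cast_add, hn, hn1] at hn2
    simpa using hn2
  filter_upwards [h] with n hn
  rw [← ZMod.natCast_eq_zero_iff, hn, hz0]

theorem exists_isIdempotentUF_digitString {B : ℕ} (hB : 1 < B) :
    ∃ U : Ultrafilter ℕ, IsIdempotentUF U ∧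
      ∀ d < B, ∀ᶠ x in U, UEquiv (digitString B (x * d)) [(d : ℤ)] := by
  let s : Stream' ℕ := fun i => B ^ i
  have hs : ∀ i, s.get i = B ^ (0 + i) := fun i => by rw [zero_add]; rfl
  obtain ⟨U, hU, hFS⟩ := Hindman.exists_idempotent_ultrafilter_le_FS s
  have hU' : pseudoSum U U = U := hU
  refine ⟨U, ⟨?_, hU'⟩, fun d hd => hFS.mono fun x hx =>
    (digitString_mul_of_mem_FS hB hd hx 0 hs).1⟩
  rintro n rfl
  have h0 : n + n = n := by
    have h : ∀ᶠ x in pseudoSum (pure n) (pure n), x = n := by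
      rw [hU']; simp [Ultrafilter.coe_pure]
    simpa [eventually_pseudoSum, Ultrafilter.coe_pure] using h
  have hn : n ∈ Hindman.FS s := by simpa [Ultrafilter.coe_pure] using hFS
  have := (digitString_mul_of_mem_FS hB hB hn 0 hs).2.2
  omega

theorem eventually_oplusU_dvd {U : Ultrafilter ℕ} {m : ℕ} (hU : ∀ᶠ n in U, m ∣ n)
    (l : List ℕ) : ∀ᶠ n in oplusU U l, m ∣ n := by
  induction l with
  | nil => simp [oplusU, Ultrafilter.coe_pure]
  | cons d l ih =>
    rw [oplusU_cons, eventually_pseudoSum, eventually_smulU]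
    filter_upwards [hU] with x hx
    filter_upwards [ih] with y hy
    exact dvd_add (hx.mul_right d) hy

theorem eventually_oplusU_digitString {B : ℕ} (hB : 1 < B) {U : Ultrafilter ℕ}
    (hU : pseudoSum U U = U)
    (hd : ∀ d < B, ∀ᶠ x in U, UEquiv (digitString B (x * d)) [(d : ℤ)])
    (l : List ℕ) (hl : ∀ d ∈ l, d < B) :
    ∀ᶠ n in oplusU U l, UEquiv (digitString B n) (l.map Nat.cast) := by
  have : NeZero B := ⟨by omega⟩
  induction l with
  | nil => simpa [oplusU, Ultrafilter.coe_pure, digitString] using UEquiv.refl _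
  | cons d l ih =>
    rw [oplusU_cons, eventually_pseudoSum, eventually_smulU]
    filter_upwards [hd d (hl d (by simp))] with x hx
    filter_upwards [ih fun e he => hl e (by simp [he]),
      eventually_oplusU_dvd (eventually_dvd_of_pseudoSum_self hU (B ^ (x * d))) l] with y hy hdvd
    exact (digitString_add_of_dvd hB (x * d) (Nat.lt_pow_self hB) hdvd).trans
      (UEquiv.append hx hy)

/-- `⟨a₀, …, a_k⟩ ≈ᵤ ⟨b₀, …, b_h⟩` iff the corresponding linear combinations
of every idempotent ultrafilter coincide. -/
theorem uequiv_iff_oplus_eq (k h : ℕ) (a : Fin (k + 1) → ℕ) (b : Fin (h + 1) → ℕ) :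
    UEquiv ((List.ofFn a).map fun m => (m : ℤ)) ((List.ofFn b).map fun m => (m : ℤ)) ↔
      ∀ U : Ultrafilter ℕ, IsIdempotentUF U →
        oplusU U (List.ofFn a) = oplusU U (List.ofFn b) := by
  have hcast (l : List ℕ) : (l.map fun m => (m : ℤ)) = l.map Nat.cast := by
    simp [List.map_eq_flatMap]
  rw [hcast, hcast]
  constructor
  · intro hab U hU
    have h := hab.oplusU_map_toNat_eq hU.2
    have hid (l : List ℕ) : (l.map (Nat.cast : ℕ → ℤ)).map Int.toNat = l := by
      rw [List.map_map]
      exact List.map_id l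
    rwa [hid, hid] at h
  · intro hab
    let B := (List.ofFn a).sum + (List.ofFn b).sum + 2
    have hB : 1 < B := by omega
    obtain ⟨U, hU, hd⟩ := exists_isIdempotentUF_digitString hB
    have ha := eventually_oplusU_digitString hB hU.2 hd (List.ofFn a) fun d hd => by
      have := List.le_sum_of_mem hd
      omega
    have hb := eventually_oplusU_digitString hB hU.2 hd (List.ofFn b) fun d hd => by
      have := List.le_sum_of_mem hd
      omega
    rw [← hab U hU] at hb
    obtain ⟨n, hna, hnb⟩ := (ha.and hb).exists
    exact hna.symm.trans hnb
end

section
/- Let U be an idempotent ultrafilter on ℕ₀. Then every set A ∈ 2U ⊕ U contains a 3-term arithmetic progression; that is, there exist x ∈ A and d > 0 such that x, x + d, and x + 2d all belong to A. -/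
open Ultrafilter Polynomial

theorem mem_pseudoSum {U V : Ultrafilter ℕ} {A : Set ℕ} :
    A ∈ pseudoSum U V ↔ ∀ᶠ n in (U : Filter ℕ), ∀ᶠ m in (V : Filter ℕ), n + m ∈ A :=
  Iff.rfl

theorem IsIdempotentUF.eventually_eventually_add {U : Ultrafilter ℕ} (hU : IsIdempotentUF U)
    {S : Set ℕ} (hS : ∀ᶠ n in (U : Filter ℕ), n ∈ S) :
    ∀ᶠ n in (U : Filter ℕ), ∀ᶠ m in (U : Filter ℕ), n + m ∈ S := by
  rw [← mem_pseudoSum, hU.2]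
  exact hS

theorem IsIdempotentUF.eventually_pos {U : Ultrafilter ℕ} (hU : IsIdempotentUF U) :
    ∀ᶠ n in (U : Filter ℕ), 0 < n := by
  have h : ({0} : Set ℕ) ∉ U := fun h0 => by
    obtain ⟨x, -, hx⟩ := Ultrafilter.eq_pure_of_finite_mem (Set.finite_singleton 0) h0
    exact hU.1 x hx
  filter_upwards [Ultrafilter.compl_mem_iff_notMem.2 h] with n hn
  exact Nat.pos_of_ne_zero hn

/-- For every idempotent ultrafilter `U`, every `A ∈ 2U ⊕ U` contains a 3-term
arithmetic progression. -/
theorem ap3_of_mem_2U_oplus_U (U : Ultrafilter ℕ) (hU : IsIdempotentUF U)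
    (A : Set ℕ) (hA : A ∈ pseudoSum (smulU 2 U) U) :
    ∃ x d : ℕ, 0 < d ∧ x ∈ A ∧ x + d ∈ A ∧ x + 2 * d ∈ A := by
  have hB : ∀ᶠ n in (U : Filter ℕ), ∀ᶠ m in (U : Filter ℕ), n * 2 + m ∈ A := hA
  obtain ⟨a, ha, hab⟩ := (hB.and (hU.eventually_eventually_add hB)).exists
  obtain ⟨b, hb, hb', hb0⟩ := (hab.and
    ((hU.eventually_eventually_add (S := {m | a * 2 + m ∈ A}) ha).and hU.eventually_pos)).exists
  obtain ⟨c, hc, hc', hc''⟩ := (ha.and (hb'.and hb)).exists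
  refine ⟨a * 2 + c, b, hb0, hc, ?_, ?_⟩
  · have h : a * 2 + (b + c) ∈ A := hc'
    convert h using 1
    ring
  · convert hc'' using 1
    ring
end
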